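/- For every node t ∈ V, the second moment of the estimator q = d_t/(n·d_X), where X has law P(X = v) = π(t,v), is bounded by ∑_{v ∈ V} (d_t²/(n²·d_v²))·π(t,v) ≤ d_t·π(t)/(n·d_min); consequently Var[q] ≤ d_t·π(t)/(n·d_min). -/

import Mathlib

open Matrix Finset MeasureTheory

section PageRank

variable {V : Type*} [Fintype V] (G : SimpleGraph V) [DecidableRel G.Adj]

lemma pageRank_apply [DecidableEq V] (hdeg : ∀ v : V, 0 < G.degree v) {α : ℝ} {x b : V → ℝ}
    (hx : x = (1 - α) •
      (G.adjMatrix ℝ * (Matrix.diagonal fun v => (G.degree v : ℝ))⁻¹).mulVec x + b) (u : V) :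
    x u = (1 - α) * ∑ v, G.adjMatrix ℝ u v * (x v / G.degree v) + b u := by
  have hinv : (Matrix.diagonal fun v => (G.degree v : ℝ))⁻¹
      = Matrix.diagonal fun v => (G.degree v : ℝ)⁻¹ := by
    refine Matrix.inv_eq_right_inv ?_
    rw [Matrix.diagonal_mul_diagonal, ← Matrix.diagonal_one]
    congr 1
    funext v
    exact mul_inv_cancel₀ (Nat.cast_ne_zero.2 (hdeg v).ne')
  have h := congrFun hx u
  rw [hinv] at h
  simp only [Pi.add_apply, Pi.smul_apply, smul_eq_mul, Matrix.mulVec, dotProduct,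
    Matrix.mul_diagonal] at h
  rw [h]
  congr 2
  refine Finset.sum_congr rfl fun v _ => ?_
  rw [div_eq_inv_mul, mul_assoc]

lemma sum_sum_adjMatrix_mul_div (hdeg : ∀ v : V, 0 < G.degree v) (x : V → ℝ) :
    ∑ u, ∑ v, G.adjMatrix ℝ u v * (x v / G.degree v) = ∑ v, x v := by
  rw [Finset.sum_comm]
  refine Finset.sum_congr rfl fun v _ => ?_
  have hcol : ∑ u, G.adjMatrix ℝ u v = G.degree v := by
    simp [SimpleGraph.adjMatrix_apply, G.adj_comm, ← SimpleGraph.card_neighborFinset_eq_degree,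
      SimpleGraph.neighborFinset_eq_filter]
  rw [← Finset.sum_mul, hcol, mul_div_cancel₀]
  exact Nat.cast_ne_zero.2 (hdeg v).ne'

variable {G} {α : ℝ} {x y b c : V → ℝ}

lemma sum_pageRank (hdeg : ∀ v : V, 0 < G.degree v)
    (hx : ∀ u, x u = (1 - α) * ∑ v, G.adjMatrix ℝ u v * (x v / G.degree v) + b u) :
    α * ∑ u, x u = ∑ u, b u := by
  have h : ∑ u, x u = (1 - α) * ∑ u, x u + ∑ u, b u := by
    conv_lhs => rw [Finset.sum_congr rfl fun u _ => hx u]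
    rw [Finset.sum_add_distrib, ← Finset.mul_sum, sum_sum_adjMatrix_mul_div G hdeg]
  linarith

lemma pageRank_nonneg (hdeg : ∀ v : V, 0 < G.degree v) (hα0 : 0 < α) (hα1 : α < 1)
    (hb : ∀ u, 0 ≤ b u)
    (hx : ∀ u, x u = (1 - α) * ∑ v, G.adjMatrix ℝ u v * (x v / G.degree v) + b u) (u : V) :
    0 ≤ x u := by
  have hα : 0 ≤ 1 - α := by linarith
  have hA : ∀ u v, 0 ≤ G.adjMatrix ℝ u v := fun u v => by
    rw [SimpleGraph.adjMatrix_apply]; split_ifs <;> simp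
  have hterm : ∀ u v, 0 ≤ G.adjMatrix ℝ u v * (max (-x v) 0 / G.degree v) := fun u v =>
    mul_nonneg (hA u v) (div_nonneg (le_max_right _ _) (Nat.cast_nonneg _))
  have hneg : ∀ u, max (-x u) 0
      ≤ (1 - α) * ∑ v, G.adjMatrix ℝ u v * (max (-x v) 0 / G.degree v) := by
    intro u
    refine max_le ?_ (mul_nonneg hα (Finset.sum_nonneg fun v _ => hterm u v))
    have hle : -∑ v, G.adjMatrix ℝ u v * (x v / G.degree v)
        ≤ ∑ v, G.adjMatrix ℝ u v * (max (-x v) 0 / G.degree v) := by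
      rw [← Finset.sum_neg_distrib]
      refine Finset.sum_le_sum fun v _ => ?_
      rw [← mul_neg, ← neg_div]
      exact mul_le_mul_of_nonneg_left
        (div_le_div_of_nonneg_right (le_max_left _ _) (Nat.cast_nonneg _)) (hA u v)
    have := mul_le_mul_of_nonneg_left hle hα
    linarith [hx u, hb u]
  have hsum := Finset.sum_le_sum fun u (_ : u ∈ Finset.univ) => hneg u
  rw [← Finset.mul_sum, sum_sum_adjMatrix_mul_div G hdeg] at hsum
  have hu := Finset.single_le_sum (f := fun u => max (-x u) 0)
    (fun u _ => le_max_right _ _) (Finset.mem_univ u)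
  have hS : ∑ u, max (-x u) 0 ≤ 0 := by
    by_contra! h
    nlinarith
  linarith [le_max_left (-x u) 0]

lemma sum_pageRank_div_degree_mul_comm
    (hx : ∀ u, x u = (1 - α) * ∑ v, G.adjMatrix ℝ u v * (x v / G.degree v) + b u)
    (hy : ∀ u, y u = (1 - α) * ∑ v, G.adjMatrix ℝ u v * (y v / G.degree v) + c u) :
    ∑ u, x u / G.degree u * c u = ∑ u, y u / G.degree u * b u := by
  have hsymm : ∑ u, x u / G.degree u * ∑ v, G.adjMatrix ℝ u v * (y v / G.degree v)
      = ∑ u, y u / G.degree u * ∑ v, G.adjMatrix ℝ u v * (x v / G.degree v) := by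
    simp_rw [Finset.mul_sum]
    rw [Finset.sum_comm]
    refine Finset.sum_congr rfl fun v _ => Finset.sum_congr rfl fun u _ => ?_
    have : G.adjMatrix ℝ u v = G.adjMatrix ℝ v u := G.isSymm_adjMatrix.apply v u
    rw [this]
    ring
  have hc : ∀ u, x u / G.degree u * c u = x u * y u / G.degree u
      - (1 - α) * (x u / G.degree u * ∑ v, G.adjMatrix ℝ u v * (y v / G.degree v)) := fun u => by
    rw [eq_sub_of_add_eq' (hy u).symm]
    ring
  have hb : ∀ u, y u / G.degree u * b u = x u * y u / G.degree u
      - (1 - α) * (y u / G.degree u * ∑ v, G.adjMatrix ℝ u v * (x v / G.degree v)) := fun u => by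
    rw [eq_sub_of_add_eq' (hx u).symm]
    ring
  simp_rw [hc, hb, Finset.sum_sub_distrib, ← Finset.mul_sum, hsymm]

end PageRank

section FiniteLaw

variable {Ω : Type*} [MeasurableSpace Ω] {μ : Measure Ω}

lemma nullMeasurableSet_of_measure_add_measure_compl_le [IsFiniteMeasure μ] {s : Set Ω}
    (h : μ s + μ sᶜ ≤ μ Set.univ) : NullMeasurableSet s μ := by
  set B := toMeasurable μ s
  set C := toMeasurable μ sᶜ
  have hBC : B ∪ C = Set.univ := Set.eq_univ_of_forall fun ω => by
    by_cases hω : ω ∈ s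
    · exact Or.inl (subset_toMeasurable μ s hω)
    · exact Or.inr (subset_toMeasurable μ sᶜ hω)
  have hadd := measure_union_add_inter (μ := μ) B (measurableSet_toMeasurable μ sᶜ)
  rw [hBC, measure_toMeasurable, measure_toMeasurable] at hadd
  have hzero : μ (B ∩ C) = 0 := by
    refine le_antisymm ?_ zero_le
    refine (ENNReal.add_le_add_iff_left (measure_ne_top μ Set.univ)).1 ?_
    rw [hadd, add_zero]
    exact h
  have hsub : B \ s ⊆ B ∩ C := fun ω hω => ⟨hω.1, subset_toMeasurable μ sᶜ hω.2⟩
  refine ⟨B, measurableSet_toMeasurable μ s, ?_⟩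
  refine Filter.EventuallyLE.antisymm (subset_toMeasurable μ s).eventuallyLE ?_
  exact ae_le_set.2 (measure_mono_null hsub hzero)

variable {V : Type*} [Fintype V] [IsProbabilityMeasure μ] {X : Ω → V} {p : V → ℝ}

lemma nullMeasurableSet_fiber_of_sum_eq_one (hp : ∀ v, 0 ≤ p v) (hsum : ∑ v, p v = 1)
    (hX : ∀ v, μ {ω | X ω = v} = ENNReal.ofReal (p v)) (v : V) :
    NullMeasurableSet {ω | X ω = v} μ := by
  classical
  refine nullMeasurableSet_of_measure_add_measure_compl_le ?_
  have hcompl : {ω | X ω = v}ᶜ = ⋃ w ∈ Finset.univ.erase v, {ω | X ω = w} := by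
    ext ω
    simp
  have hle : μ {ω | X ω = v}ᶜ ≤ ∑ w ∈ Finset.univ.erase v, μ {ω | X ω = w} := by
    rw [hcompl]
    exact measure_biUnion_finset_le _ _
  calc μ {ω | X ω = v} + μ {ω | X ω = v}ᶜ
      ≤ μ {ω | X ω = v} + ∑ w ∈ Finset.univ.erase v, μ {ω | X ω = w} := by gcongr
    _ = ∑ w, μ {ω | X ω = w} :=
      Finset.add_sum_erase _ (fun w => μ {ω | X ω = w}) (Finset.mem_univ v)
    _ = μ Set.univ := by
      simp_rw [hX]
      rw [← ENNReal.ofReal_sum_of_nonneg fun v _ => hp v, hsum, ENNReal.ofReal_one, measure_univ]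

lemma variance_comp_le_sum_sq (hp : ∀ v, 0 ≤ p v) (hsum : ∑ v, p v = 1)
    (hX : ∀ v, μ {ω | X ω = v} = ENNReal.ofReal (p v)) (f : V → ℝ) :
    ProbabilityTheory.variance (fun ω => f (X ω)) μ ≤ ∑ v, f v ^ 2 * p v := by
  classical
  have hnull := nullMeasurableSet_fiber_of_sum_eq_one hp hsum hX
  have hdecomp : ∀ g : V → ℝ, (fun ω => g (X ω))
      = fun ω => ∑ v, {ω | X ω = v}.indicator (fun _ => g v) ω := fun g => by
    funext ω
    simp [Set.indicator_apply]
  have hint : ∀ (g : V → ℝ) (v : V), Integrable ({ω | X ω = v}.indicator fun _ => g v) μ :=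
    fun g v => (integrable_const (g v)).indicator₀ (hnull v)
  have hmeas : AEStronglyMeasurable (fun ω => f (X ω)) μ := by
    rw [hdecomp f]
    exact (integrable_finsetSum _ fun v _ => hint f v).aestronglyMeasurable
  refine (ProbabilityTheory.variance_le_expectation_sq hmeas).trans_eq ?_
  change ∫ ω, f (X ω) ^ 2 ∂μ = _
  rw [hdecomp fun v => f v ^ 2, integral_finsetSum _ fun v _ => hint (fun v => f v ^ 2) v]
  refine Finset.sum_congr rfl fun v _ => ?_
  rw [integral_indicator₀ (hnull v), setIntegral_const, smul_eq_mul, Measure.real, hX v,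
    ENNReal.toReal_ofReal (hp v), mul_comm]

end FiniteLaw

/-- For every node `t ∈ V`, the second moment of the estimator `q = d_t/(n·d_X)`,
where `X` has law `P(X = v) = π(t,v)`, is bounded by
`∑_{v ∈ V} (d_t²/(n²·d_v²))·π(t,v) ≤ d_t·π(t)/(n·d_min)`; consequently
`Var[q] ≤ d_t·π(t)/(n·d_min)`. -/
theorem stmt_13 {V : Type*} [Fintype V] [DecidableEq V] [Nonempty V]
    (G : SimpleGraph V) [DecidableRel G.Adj]
    (hdeg : ∀ v : V, 0 < G.degree v)
    (α : ℝ) (hα0 : 0 < α) (hα1 : α < 1)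
    (pr : V → ℝ)
    (hpr : pr = (1 - α) •
        (G.adjMatrix ℝ * (Matrix.diagonal fun v => (G.degree v : ℝ))⁻¹).mulVec pr
      + (α / (Fintype.card V : ℝ)) • (1 : V → ℝ))
    (ppr : V → V → ℝ)
    (hppr : ∀ s : V, ppr s = (1 - α) •
        (G.adjMatrix ℝ * (Matrix.diagonal fun v => (G.degree v : ℝ))⁻¹).mulVec (ppr s)
      + α • (Pi.single s 1 : V → ℝ))
    (t : V)
    (Ω : Type*) [MeasurableSpace Ω] (μ : Measure Ω) [IsProbabilityMeasure μ]
    (X : Ω → V)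
    (hX : ∀ v : V, μ {ω | X ω = v} = ENNReal.ofReal (ppr t v)) :
    (∑ v : V, (G.degree t : ℝ) ^ 2 / ((Fintype.card V : ℝ) ^ 2 * (G.degree v : ℝ) ^ 2)
          * ppr t v) ≤
      (G.degree t : ℝ) * pr t /
        ((Fintype.card V : ℝ) * ((Finset.univ.inf' Finset.univ_nonempty (fun v => G.degree v) : ℕ) : ℝ)) ∧
    ProbabilityTheory.variance (fun ω => (G.degree t : ℝ) /
        ((Fintype.card V : ℝ) * (G.degree (X ω) : ℝ))) μ ≤
      (G.degree t : ℝ) * pr t /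
        ((Fintype.card V : ℝ) * ((Finset.univ.inf' Finset.univ_nonempty (fun v => G.degree v) : ℕ) : ℝ)) := by
  have hd : ∀ v, (0 : ℝ) < G.degree v := fun v => Nat.cast_pos.2 (hdeg v)
  have hn : (0 : ℝ) < Fintype.card V := Nat.cast_pos.2 Fintype.card_pos
  have hpr' := pageRank_apply G hdeg hpr
  have hppr' := pageRank_apply G hdeg (hppr t)
  have hnonneg : ∀ v, 0 ≤ ppr t v := by
    refine pageRank_nonneg hdeg hα0 hα1 (fun u => ?_) hppr'
    rw [Pi.smul_apply, Pi.single_apply, smul_eq_mul]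
    split_ifs <;> simp [hα0.le]
  have hsum : ∑ v, ppr t v = 1 := by
    have h := sum_pageRank hdeg hppr'
    simp only [Pi.smul_apply, smul_eq_mul, ← Finset.mul_sum, Finset.sum_pi_single',
      Finset.mem_univ, if_true] at h
    exact mul_left_cancel₀ hα0.ne' h
  have hdual : ∑ v, ppr t v / G.degree v = Fintype.card V * (pr t / G.degree t) := by
    have h := sum_pageRank_div_degree_mul_comm hppr' hpr'
    simp only [Pi.smul_apply, Pi.one_apply, smul_eq_mul, mul_one, ← Finset.sum_mul,
      Pi.single_apply, mul_ite, mul_zero, Finset.sum_ite_eq', Finset.mem_univ, if_true] at h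
    field_simp at h ⊢
    linarith
  obtain ⟨w, -, hw⟩ := Finset.exists_mem_eq_inf' Finset.univ_nonempty fun v => G.degree v
  have hmin : ∀ v, (G.degree w : ℝ) ≤ G.degree v := fun v => by
    rw [← hw]
    exact Nat.cast_le.2 (Finset.inf'_le _ (Finset.mem_univ v))
  have hmoment : (∑ v : V, (G.degree t : ℝ) ^ 2
      / ((Fintype.card V : ℝ) ^ 2 * (G.degree v : ℝ) ^ 2) * ppr t v) ≤
      (G.degree t : ℝ) * pr t / ((Fintype.card V : ℝ) *
        ((Finset.univ.inf' Finset.univ_nonempty (fun v => G.degree v) : ℕ) : ℝ)) := by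
    rw [hw]
    have hdw := hd w
    have hdt := hd t
    calc (∑ v : V, (G.degree t : ℝ) ^ 2
          / ((Fintype.card V : ℝ) ^ 2 * (G.degree v : ℝ) ^ 2) * ppr t v)
        ≤ ∑ v : V, (G.degree t : ℝ) ^ 2 / ((Fintype.card V : ℝ) ^ 2 * G.degree w)
          * (ppr t v / G.degree v) := by
          refine Finset.sum_le_sum fun v _ => ?_
          have hdv := hd v
          have hrw : (G.degree t : ℝ) ^ 2 / ((Fintype.card V : ℝ) ^ 2 * (G.degree v : ℝ) ^ 2)
              * ppr t v = (G.degree t : ℝ) ^ 2 / ((Fintype.card V : ℝ) ^ 2 * G.degree v)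
              * (ppr t v / G.degree v) := by
            field_simp
          rw [hrw]
          refine mul_le_mul_of_nonneg_right ?_ (div_nonneg (hnonneg v) hdv.le)
          have := hmin v
          gcongr
      _ = (G.degree t : ℝ) * pr t / ((Fintype.card V : ℝ) * G.degree w) := by
          rw [← Finset.mul_sum, hdual]
          field_simp
  refine ⟨hmoment, le_trans ?_ hmoment⟩
  refine (variance_comp_le_sum_sq hnonneg hsum hX
    fun v => (G.degree t : ℝ) / ((Fintype.card V : ℝ) * G.degree v)).trans_eq ?_
  simp_rw [div_pow, mul_pow]
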